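/- arXiv:2206.10752 — 2 statements merged into one kernel-verified Lean document; each statement's English description precedes it below -/
import Mathlib

section
/- Let G be a finite nonabelian 3-group (a group of order a power of 3) that is minimally faithful of degree 3. Then either (a) G is isomorphic to the Heisenberg group of order 27, i.e., the group of upper unitriangular 3×3 matrices over ℤ/3ℤ (equivalently, G has order 27 and every element g of G satisfies g³ = 1), or (b) there exists k ≥ 2 such that G is isomorphic to the semidirect product C_{3^k} ⋊ C_3 in which a generator of C_3 acts on the cyclic group C_{3^k} by the automorphism a ↦ a^{1+3^{k-1}}. -/
/-- `rdim G` is the smallest `n` such that `G` has a faithful `n`-dimensional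
complex representation, i.e. an injective group homomorphism `G →* GL n ℂ`. -/
noncomputable def rdim (G : Type*) [Group G] : ℕ :=
  sInf {n : ℕ | ∃ ρ : G →* GL (Fin n) ℂ, Function.Injective ρ}

/-- `G` is minimally faithful of degree `n` if `rdim G = n` and every proper
subgroup has strictly smaller representation dimension. -/
def MinFaithful (G : Type*) [Group G] (n : ℕ) : Prop :=
  rdim G = n ∧ ∀ H : Subgroup G, H ≠ ⊤ → rdim H < n

open Module in
theorem aux_ss {V : Type*} [AddCommGroup V] [Module ℂ V] [FiniteDimensional ℂ V]
    (c : End ℂ V) (N : ℕ) (hN : N ≠ 0) (hc : c ^ N = 1) (f g : End ℂ V)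
    (hfg : ∀ a : ℂ, ∀ v ∈ c.eigenspace a, f v = g v) : f = g := by
  have hs : c.IsSemisimple := by
    refine End.isSemisimple_of_squarefree_aeval_eq_zero (p := (Polynomial.X ^ N - 1)) ?_ ?_
    · exact (Polynomial.X_pow_sub_one_separable_iff.2 (by exact_mod_cast hN)).squarefree
    · simp [hc]
  have ht := End.iSup_maxGenEigenspace_eq_top c
  simp_rw [hs.isFinitelySemisimple.maxGenEigenspace_eq_eigenspace] at ht
  have h2 : (⊤ : Submodule ℂ V) ≤ LinearMap.eqLocus f g := by
    rw [← ht]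
    exact iSup_le fun a v hv => hfg a v hv
  ext v
  exact h2 (Submodule.mem_top)

open Module in
theorem aux_det {V : Type*} [AddCommGroup V] [Module ℂ V] [FiniteDimensional ℂ V]
    (x y : End ℂ V) (hx : Function.Injective x) (hy : Function.Injective y) (a : ℂ)
    (h : x * y = a • (y * x)) : a ^ finrank ℂ V = 1 := by
  have hx' : LinearMap.det x ≠ 0 :=
    (LinearMap.isUnit_det x ((LinearMap.isUnit_iff_ker_eq_bot x).2 (LinearMap.ker_eq_bot.2 hx))).ne_zero
  have hy' : LinearMap.det y ≠ 0 :=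
    (LinearMap.isUnit_det y ((LinearMap.isUnit_iff_ker_eq_bot y).2 (LinearMap.ker_eq_bot.2 hy))).ne_zero
  have := congrArg LinearMap.det h
  rw [LinearMap.det_smul, map_mul, map_mul] at this
  have h3 : (a ^ finrank ℂ V - 1) * (LinearMap.det x * LinearMap.det y) = 0 := by
    linear_combination -this
  rcases mul_eq_zero.1 h3 with h | h
  · exact sub_eq_zero.1 h
  · exact absurd h (mul_ne_zero hx' hy')

theorem aux_maps {V : Type*} [AddCommGroup V] [Module ℂ V] {c x : Module.End ℂ V}
    (h : Commute c x) (a : ℂ) : ∀ v ∈ c.eigenspace a, x v ∈ c.eigenspace a := by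
  intro v hv
  rw [Module.End.mem_eigenspace_iff] at *
  have := congrArg (fun f => f v) h.eq
  simp only [Module.End.mul_apply] at this
  rw [this, hv, map_smul]

open Module in
theorem aux_two {V : Type*} [AddCommGroup V] [Module ℂ V] [FiniteDimensional ℂ V]
    (hV : finrank ℂ V ≤ 2) (x y z : End ℂ V)
    (hx : Function.Injective x) (hy : Function.Injective y) (h : x * y = z * (y * x))
    (hzx : Commute z x) (hzy : Commute z y) (j : ℕ) (hz : z ^ (3 ^ j) = 1) : z = 1 := by
  refine aux_ss z (3 ^ j) (by positivity) hz _ _ ?_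
  intro a v hv
  by_cases hv0 : v = 0
  · simp [hv0]
  have hz1 : ∀ n, (z ^ n) v = a ^ n • v := by
    intro n
    induction n with
    | zero => simp
    | succ n ih =>
      rw [pow_succ', End.mul_apply, ih, map_smul, End.mem_eigenspace_iff.1 hv, smul_smul, pow_succ]
  have ha3 : a ^ (3 ^ j) = 1 := by
    have := hz1 (3 ^ j)
    rw [hz, End.one_apply] at this
    have h4 : (a ^ (3 ^ j) - 1) • v = 0 := by rw [sub_smul, ← this]; simp
    rcases smul_eq_zero.1 h4 with h | h
    · exact sub_eq_zero.1 h
    · exact absurd h hv0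
  let X := x.restrict (aux_maps hzx a)
  let Y := y.restrict (aux_maps hzy a)
  have hd : a ^ finrank ℂ (z.eigenspace a) = 1 := by
    refine aux_det X Y ?_ ?_ a ?_
    · intro u w huw; exact Subtype.ext (hx (congrArg Subtype.val huw))
    · intro u w huw; exact Subtype.ext (hy (congrArg Subtype.val huw))
    · ext ⟨w, hw⟩
      have h5 := congrArg (fun f => f w) h
      simp only [End.mul_apply] at h5
      have h6 := aux_maps hzy a _ (aux_maps hzx a _ hw)
      rw [End.mem_eigenspace_iff.1 h6] at h5
      simpa [X, Y] using h5
  have hle : finrank ℂ (z.eigenspace a) ≤ 2 := (Submodule.finrank_le _).trans hV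
  have hpos : 0 < finrank ℂ (z.eigenspace a) := by
    rw [finrank_pos_iff]
    exact ⟨⟨v, hv⟩, 0, fun h => hv0 (congrArg Subtype.val h)⟩
  have h2 : a ^ 2 = 1 := by
    interval_cases hh : finrank ℂ (z.eigenspace a)
    · rw [pow_one] at hd; simp [hd]
    · exact hd
  have ha : a = 1 := by
    have h1 := orderOf_dvd_of_pow_eq_one ha3
    have h2 := orderOf_dvd_of_pow_eq_one h2
    have : Nat.Coprime (3 ^ j) 2 := Nat.Coprime.pow_left _ (by norm_num)
    exact orderOf_eq_one_iff.1 (Nat.dvd_one.1 (this ▸ Nat.dvd_gcd h1 h2))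
  rw [End.mem_eigenspace_iff.1 hv, ha]; simp

open Module in
theorem aux_three {V : Type*} [AddCommGroup V] [Module ℂ V] [FiniteDimensional ℂ V]
    (hV : finrank ℂ V = 3) (x y z c : End ℂ V)
    (hx : Function.Injective x) (hy : Function.Injective y) (h : x * y = z * (y * x))
    (hzx : Commute z x) (hzy : Commute z y) (j : ℕ) (hz : z ^ (3 ^ j) = 1) (hz1 : z ≠ 1)
    (hcx : Commute c x) (hcy : Commute c y) (hcz : Commute c z) (N : ℕ) (hN : N ≠ 0)
    (hc : c ^ N = 1) : ∃ a : ℂ, c = a • 1 := by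
  by_contra hne
  push Not at hne
  refine hz1 (aux_ss c N hN hc _ _ ?_)
  intro a v hv
  have hlt : finrank ℂ (c.eigenspace a) < 3 := by
    rw [← hV]
    apply Submodule.finrank_lt
    intro htop
    apply hne a
    ext w
    have : w ∈ c.eigenspace a := by rw [htop]; trivial
    simpa using End.mem_eigenspace_iff.1 this
  let X : End ℂ (c.eigenspace a) := x.restrict (aux_maps hcx a)
  let Y : End ℂ (c.eigenspace a) := y.restrict (aux_maps hcy a)
  let Z : End ℂ (c.eigenspace a) := z.restrict (aux_maps hcz a)
  have hZ : Z = 1 := by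
    refine aux_two (by omega) X Y Z ?_ ?_ ?_ ?_ ?_ j ?_
    · intro u w huw; exact Subtype.ext (hx (congrArg Subtype.val huw))
    · intro u w huw; exact Subtype.ext (hy (congrArg Subtype.val huw))
    · ext ⟨w, hw⟩
      exact congrArg (fun f => f w) h
    · ext ⟨w, hw⟩
      exact congrArg (fun f => f w) hzx.eq
    · ext ⟨w, hw⟩
      exact congrArg (fun f => f w) hzy.eq
    · have : ∀ n (w : c.eigenspace a), ((Z ^ n) w : V) = (z ^ n) w := by
        intro n
        induction n with
        | zero => intro w; simp
        | succ n ih =>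
          intro w
          rw [pow_succ', pow_succ', End.mul_apply, End.mul_apply, ← ih]
          rfl
      ext w
      rw [this, hz]; rfl
  exact congrArg Subtype.val (congrArg (fun f => f ⟨v, hv⟩) hZ)

/-- the linear representation attached to a matrix one -/
noncomputable def auxRep {G : Type*} [Group G] {n : ℕ} (ρ : G →* GL (Fin n) ℂ) :
    G →* Module.End ℂ (Fin n → ℂ) :=
  ((Matrix.toLinAlgEquiv' (R := ℂ) (n := Fin n)).toAlgHom : _ →* _).comp
    ((Units.coeHom _).comp ρ)

theorem auxRep_inj {G : Type*} [Group G] {n : ℕ} (ρ : G →* GL (Fin n) ℂ)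
    (h : Function.Injective ρ) : Function.Injective (auxRep ρ) := by
  intro a b hab
  apply h
  apply Units.ext
  exact (Matrix.toLinAlgEquiv' (R := ℂ) (n := Fin n)).injective hab

theorem aux_opinj {G : Type*} [Group G] {V : Type*} [AddCommGroup V] [Module ℂ V]
    (τ : G →* Module.End ℂ V) (g : G) : Function.Injective (τ g) := by
  intro v w h
  have h2 := congrArg (τ g⁻¹) h
  simpa [← Module.End.mul_apply, ← map_mul] using h2

/-- in a nonabelian finite 3-group there is a nontrivial central commutator -/
theorem aux_comm {G : Type*} [Group G] [Finite G] (hp : IsPGroup 3 G)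
    (hna : ¬ ∀ a b : G, a * b = b * a) :
    ∃ x y z : G, x * y = z * (y * x) ∧ (∀ g, g * z = z * g) ∧ z ≠ 1 := by
  have : Fact (Nat.Prime 3) := ⟨by norm_num⟩
  have hnt : Nontrivial (G ⧸ Subgroup.center G) := by
    rw [QuotientGroup.nontrivial_iff]
    intro h
    apply hna
    intro a b
    have : b ∈ Subgroup.center G := by rw [h]; trivial
    exact Subgroup.mem_center_iff.1 this a
  have := (hp.to_quotient (Subgroup.center G)).center_nontrivial
  obtain ⟨⟨q, hq⟩, hq1⟩ := exists_ne (1 : Subgroup.center (G ⧸ Subgroup.center G))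
  obtain ⟨x, rfl⟩ := QuotientGroup.mk_surjective q
  have hx : x ∉ Subgroup.center G := by
    intro h
    apply hq1
    apply Subtype.ext
    exact (QuotientGroup.eq_one_iff x).2 h
  rw [Subgroup.mem_center_iff] at hx
  push Not at hx
  obtain ⟨y, hy⟩ := hx
  refine ⟨x, y, x * y * x⁻¹ * y⁻¹, by group, ?_, ?_⟩
  · have : x * y * x⁻¹ * y⁻¹ ∈ Subgroup.center G := by
      rw [← QuotientGroup.eq_one_iff]
      have h := Subgroup.mem_center_iff.1 hq (y : G ⧸ Subgroup.center G)
      simp only [QuotientGroup.mk_mul, QuotientGroup.mk_inv]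
      rw [← h]; group
    exact Subgroup.mem_center_iff.1 this
  · intro h
    apply hy
    have : x * y = (x * y * x⁻¹ * y⁻¹) * (y * x) := by group
    rw [this, h, one_mul]

theorem aux_abel {G : Type*} [Group G] [Finite G] (hp : IsPGroup 3 G) {n : ℕ} (hn : n ≤ 2)
    (ρ : G →* GL (Fin n) ℂ) (hρ : Function.Injective ρ) : ∀ a b : G, a * b = b * a := by
  by_contra hna
  obtain ⟨x, y, z, h, hz, hz1⟩ := aux_comm hp hna
  obtain ⟨j, hj⟩ := hp z
  apply hz1
  apply auxRep_inj ρ hρ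
  rw [map_one]
  refine aux_two (by simpa using hn) (auxRep ρ x) (auxRep ρ y) _ (aux_opinj _ _) (aux_opinj _ _)
    ?_ ?_ ?_ j ?_
  · rw [← map_mul, h, map_mul, map_mul _ y x]
  · exact (show Commute z x from (hz x).symm).map _
  · exact (show Commute z y from (hz y).symm).map _
  · rw [← map_pow, hj, map_one]

/-- all we need from the hypotheses -/
theorem aux_facts {G : Type*} [Group G] [Finite G] (hp : IsPGroup 3 G)
    (hna : ¬ ∀ a b : G, a * b = b * a) (ρ : G →* GL (Fin 3) ℂ) (hρ : Function.Injective ρ) :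
    ∃ x y z : G, x * y = z * (y * x) ∧ (∀ g, g * z = z * g) ∧ z ≠ 1 ∧ z ^ 3 = 1 ∧
      IsCyclic (Subgroup.center G) := by
  obtain ⟨x, y, z, h, hz, hz1⟩ := aux_comm hp hna
  have hsc : ∀ c ∈ Subgroup.center G, ∃ a : ℂ, auxRep ρ c = a • 1 := by
    intro c hc
    rw [Subgroup.mem_center_iff] at hc
    obtain ⟨j, hj⟩ := hp z
    obtain ⟨l, hl⟩ := hp c
    refine aux_three (by simp) (auxRep ρ x) (auxRep ρ y) (auxRep ρ z) _ (aux_opinj _ _) (aux_opinj _ _)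
      ?_ ?_ ?_ j ?_ ?_ ?_ ?_ ?_ (3 ^ l) (by positivity) ?_
    · rw [← map_mul, h, map_mul, map_mul _ y x]
    · exact (show Commute z x from (hz x).symm).map _
    · exact (show Commute z y from (hz y).symm).map _
    · rw [← map_pow, hj, map_one]
    · intro h; exact hz1 (auxRep_inj ρ hρ (h.trans (map_one _).symm))
    · exact (show Commute c x from (hc x).symm).map _
    · exact (show Commute c y from (hc y).symm).map _
    · exact (show Commute c z from (hc z).symm).map _
    · rw [← map_pow, hl, map_one]
  refine ⟨x, y, z, h, hz, hz1, ?_, ?_⟩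
  · obtain ⟨a, ha⟩ := hsc z (Subgroup.mem_center_iff.2 hz)
    have h3 := aux_det (auxRep ρ x) (auxRep ρ y) (aux_opinj _ _) (aux_opinj _ _) a (by
      rw [← map_mul, h, map_mul, map_mul _ y x, ha]; simp)
    apply auxRep_inj ρ hρ
    simp only [Module.finrank_fintype_fun_eq_card, Fintype.card_fin] at h3
    rw [map_pow, ha, smul_pow, h3]; simp
  · choose! f hf using hsc
    have hinj : ∀ a b : ℂ, a • (1 : Module.End ℂ (Fin 3 → ℂ)) = b • 1 → a = b := by
      intro a b hab
      have := congrFun (congrArg (fun f => f (fun _ => (1 : ℂ))) hab) 0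
      simpa using this
    let F : Subgroup.center G →* ℂ :=
      { toFun := fun c => f c
        map_one' := by
          apply hinj
          rw [← hf _ (1 : Subgroup.center G).2]; simp
        map_mul' := by
          intro a b
          apply hinj
          rw [← hf _ (a * b).2, mul_smul, Subgroup.coe_mul, map_mul, hf _ a.2, hf _ b.2]; simp [smul_smul, mul_comm] }
    refine isCyclic_of_injective_ringHom F ?_
    intro a b hab
    apply Subtype.ext
    apply auxRep_inj ρ hρ
    rw [hf _ a.2, hf _ b.2]
    exact congrArg (· • _) hab

theorem aux_lift {H : Type*} [Group H] (n : ℕ) (g : H) (hg : g ^ n = 1) :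
    ∃ f : Multiplicative (ZMod n) →* H, f (Multiplicative.ofAdd 1) = g := by
  let F : ZMod n →+ Additive H := ZMod.lift n ⟨zmultiplesHom (Additive H) (Additive.ofMul g), by
    simp only [zmultiplesHom_apply]
    rw [← ofMul_zpow, zpow_natCast, hg, ofMul_one]⟩
  refine ⟨AddMonoidHom.toMultiplicativeLeft F, ?_⟩
  have h1 : F 1 = Additive.ofMul g := by
    have := ZMod.lift_coe n ⟨zmultiplesHom (Additive H) (Additive.ofMul g), by
      simp only [zmultiplesHom_apply]
      rw [← ofMul_zpow, zpow_natCast, hg, ofMul_one]⟩ 1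
    simpa using this
  simp [h1]

theorem aux_gen (n : ℕ) [NeZero n] (a : Multiplicative (ZMod n)) :
    ∃ m : ℕ, m < n ∧ a = (Multiplicative.ofAdd 1) ^ m := by
  refine ⟨(Multiplicative.toAdd a).val, ZMod.val_lt _, ?_⟩
  rw [← ofAdd_nsmul]
  simp

theorem aux_caseB {G : Type*} [Group G] (k : ℕ) (x t : G) (hx : orderOf x = 3 ^ (k + 2))
    (ht : t ^ 3 = 1) (hxt : t * x = x ^ (1 + 3 ^ (k + 1)) * t) (hne : t * x ≠ x * t)
    (hcl : Subgroup.closure {x, t} = ⊤) :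
    ∃ φ : Multiplicative (ZMod 3) →* MulAut (Multiplicative (ZMod (3 ^ (k + 2)))),
        (∀ a : Multiplicative (ZMod (3 ^ (k + 2))),
          φ (Multiplicative.ofAdd 1) a = a ^ (1 + 3 ^ (k + 1))) ∧
        Nonempty (G ≃* (Multiplicative (ZMod (3 ^ (k + 2))) ⋊[φ] Multiplicative (ZMod 3))) := by
  have : NeZero (3 ^ (k + 2)) := ⟨by positivity⟩
  set q := 1 + 3 ^ (k + 1) with hq
  have hA : ∀ a : Multiplicative (ZMod (3 ^ (k + 2))), a ^ (3 ^ (k + 2)) = 1 := by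
    intro a
    rw [← ofAdd_toAdd a, ← ofAdd_nsmul]
    simp
  have hq3 : q ^ 3 = 1 + 3 ^ (k + 2) * (1 + 3 * 3 ^ k + 3 * (3 ^ k) ^ 2) := by
    rw [hq]; ring
  have hA3 : ∀ a : Multiplicative (ZMod (3 ^ (k + 2))), a ^ (q ^ 3) = a := by
    intro a
    rw [hq3, pow_add a, pow_mul a, hA]; simp
  let σ : MulAut (Multiplicative (ZMod (3 ^ (k + 2)))) :=
    { toFun := fun a => a ^ q
      invFun := fun a => a ^ (q ^ 2)
      left_inv := by intro a; simp only []; rw [← pow_mul, ← pow_succ', hA3]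
      right_inv := by intro a; simp only []; rw [← pow_mul, ← pow_succ, hA3]
      map_mul' := fun a b => mul_pow a b q }
  have hσ : ∀ a, σ a = a ^ q := fun a => rfl
  have hσ3 : σ ^ 3 = 1 := by
    ext1 a
    rw [pow_succ σ, pow_two σ, MulAut.mul_apply, MulAut.mul_apply, hσ, hσ, hσ, ← pow_mul, ← pow_mul,
      MulAut.one_apply, ← pow_two q, ← pow_succ' q, hA3]
  obtain ⟨φ, hφ⟩ := aux_lift 3 σ hσ3
  obtain ⟨f, hf⟩ := aux_lift (3 ^ (k + 2)) x (by rw [← hx]; exact pow_orderOf_eq_one x)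
  obtain ⟨g, hg⟩ := aux_lift 3 t ht
  have hconj : t * x * t⁻¹ = x ^ q := by rw [hxt]; group
  have hone : ∀ a, f (σ a) = t * f a * t⁻¹ := by
    intro a
    obtain ⟨m, -, rfl⟩ := aux_gen _ a
    rw [hσ, map_pow, map_pow, hf, ← conj_pow, hconj, ← pow_mul, ← pow_mul, mul_comm]
  have hall : ∀ (n : ℕ) a, f (φ (Multiplicative.ofAdd 1 ^ n) a) = t ^ n * f a * (t ^ n)⁻¹ := by
    intro n
    induction n with
    | zero => intro a; simp
    | succ n ih =>
      intro a
      rw [pow_succ (Multiplicative.ofAdd (1 : ZMod 3)), map_mul, MulAut.mul_apply, ih, hφ, hone,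
        pow_succ t]; group
  have hcond : ∀ b, f.comp (MulEquiv.toMonoidHom (φ b)) =
      (MulEquiv.toMonoidHom (MulAut.conj (g b))).comp f := by
    intro b
    obtain ⟨m, -, rfl⟩ := aux_gen _ b
    apply MonoidHom.ext
    intro a
    simp only [MonoidHom.comp_apply, MulEquiv.coe_toMonoidHom, MulAut.conj_apply]
    rw [hall, map_pow g, hg]
  refine ⟨φ, fun a => by rw [hφ, hσ], ⟨(MulEquiv.ofBijective (SemidirectProduct.lift f g hcond)
    ⟨?_, ?_⟩).symm⟩⟩
  · rw [injective_iff_map_eq_one]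
    rintro ⟨a, b⟩ hab
    obtain ⟨m, hm, rfl⟩ := aux_gen _ a
    obtain ⟨n, hn, rfl⟩ := aux_gen _ b
    have hab' : x ^ m * t ^ n = 1 := by
      rw [SemidirectProduct.mk_eq_inl_mul_inr, map_mul, SemidirectProduct.lift_inl,
        SemidirectProduct.lift_inr, map_pow f, map_pow g, hf, hg] at hab
      exact hab
    have hc : Commute (t ^ n) x := by
      have : t ^ n = (x ^ m)⁻¹ := (inv_eq_of_mul_eq_one_right hab').symm
      rw [this]
      exact ((Commute.refl x).pow_left m).inv_left
    have hn0 : n = 0 := by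
      interval_cases n
      · rfl
      · rw [pow_one] at hc; exact absurd hc.eq hne
      · have h2 := hc.pow_left 2
        rw [← pow_mul] at h2
        have : t ^ (2 * 2) = t := by rw [show 2 * 2 = 3 + 1 from rfl, pow_add, ht]; simp
        rw [this] at h2
        exact absurd h2.eq hne
    subst hn0
    have hm0 : m = 0 := by
      rw [pow_zero, mul_one] at hab'
      have := orderOf_dvd_of_pow_eq_one hab'
      rw [hx] at this
      exact Nat.eq_zero_of_dvd_of_lt this hm
    subst hm0
    simp only [pow_zero]
    rfl
  · rw [← MonoidHom.range_eq_top, eq_top_iff, ← hcl, Subgroup.closure_le]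
    rintro u (rfl | rfl)
    · exact ⟨SemidirectProduct.inl (Multiplicative.ofAdd 1), by rw [SemidirectProduct.lift_inl, hf]⟩
    · exact ⟨SemidirectProduct.inr (Multiplicative.ofAdd 1), by rw [SemidirectProduct.lift_inr, hg]⟩

theorem aux_pow {G : Type*} [Group G] (a b z : G) (h : a * b = z * (b * a))
    (hz : ∀ g, g * z = z * g) (i j : ℕ) : a ^ i * b ^ j = z ^ (i * j) * (b ^ j * a ^ i) := by
  have h1 : ∀ i : ℕ, a ^ i * b = z ^ i * (b * a ^ i) := by
    intro i
    induction i with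
    | zero => simp
    | succ i ih =>
      have hc : a * z ^ i = z ^ i * a := (show Commute a z from hz a).pow_right i
      calc a ^ (i + 1) * b = a * (a ^ i * b) := by rw [pow_succ', mul_assoc]
        _ = (a * z ^ i) * (b * a ^ i) := by rw [ih, mul_assoc]
        _ = z ^ i * (a * b) * a ^ i := by rw [hc]; group
        _ = _ := by rw [h, pow_succ z, pow_succ' a]; group
  induction j with
  | zero => simp
  | succ j ih =>
    have hc : b ^ j * z ^ i = z ^ i * b ^ j :=
      ((show Commute b z from hz b).pow_right i).pow_left j
    calc a ^ i * b ^ (j + 1) = (a ^ i * b ^ j) * b := by rw [pow_succ, mul_assoc]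
      _ = z ^ (i * j) * b ^ j * (a ^ i * b) := by rw [ih]; group
      _ = z ^ (i * j) * (b ^ j * z ^ i) * (b * a ^ i) := by rw [h1]; group
      _ = _ := by rw [hc, mul_add, mul_one, pow_add z, pow_succ b]; group

theorem aux_cube {G : Type*} [Group G] (a b z : G) (h : a * b = z * (b * a))
    (hz : ∀ g, g * z = z * g) (hz3 : z ^ 3 = 1) : (a * b) ^ 3 = a ^ 3 * b ^ 3 := by
  have h1 := aux_pow a b z h hz
  have h2 := h1 2 1
  have h3 := h1 3 2
  have hb : Commute z b := (hz b).symm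
  have ha : Commute z a := (hz a).symm
  have e1 : a ^ 3 * b ^ 2 = b ^ 2 * a ^ 3 := by
    rw [h3, show 3 * 2 = 3 + 3 from rfl, pow_add, hz3]; simp
  have e2 : b * a = z⁻¹ * (a * b) := by rw [h]; group
  have hzi : ∀ g, g * z⁻¹ = z⁻¹ * g := fun g => ((show Commute g z from hz g).inv_right).eq
  calc (a * b) ^ 3 = a * (b * a) * (b * a) * b := by simp only [pow_succ, pow_zero]; group
    _ = (a * z⁻¹) * a * (b * z⁻¹) * a * b * b := by rw [e2]; group
    _ = z⁻¹ * a * a * z⁻¹ * (b * a) * b * b := by rw [hzi a, hzi b]; group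
    _ = z⁻¹ * (a * a * z⁻¹) * z⁻¹ * a * b * b * b := by rw [e2]; group
    _ = (z ^ 3)⁻¹ * a * a * a * b * b * b := by
        rw [hzi (a * a)]
        have : z⁻¹ * (z⁻¹ * (a * a)) * z⁻¹ = (z ^ 3)⁻¹ * a * a := by
          rw [hzi (z⁻¹ * (z⁻¹ * (a * a)))]; simp only [pow_succ, pow_zero]; group
        rw [this]
    _ = _ := by rw [hz3]; simp only [pow_succ, pow_zero]; group

theorem aux_caseA {G : Type*} [Group G] [Finite G] (hp : IsPGroup 3 G)
    (hna : ¬ ∀ a b : G, a * b = b * a) (a b z : G) (h : a * b = z * (b * a))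
    (hz : ∀ g, g * z = z * g) (hz3 : z ^ 3 = 1) (ha : a ^ 3 = 1) (hb : b ^ 3 = 1)
    (hcl : Subgroup.closure {a, b} = ⊤) : Nat.card G = 27 ∧ ∀ g : G, g ^ 3 = 1 := by
  have : Fact (Nat.Prime 3) := ⟨by norm_num⟩
  have hP := aux_pow a b z h hz
  have hall : ∀ g : G, ∃ i j k : ℕ, g = a ^ i * b ^ j * z ^ k := by
    have hA : ∀ g : G, (∃ i j k : ℕ, g = a ^ i * b ^ j * z ^ k) →
        (∃ i j k : ℕ, a * g = a ^ i * b ^ j * z ^ k) := by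
      rintro _ ⟨i, j, k, rfl⟩
      exact ⟨i + 1, j, k, by rw [pow_succ']; group⟩
    have hB : ∀ g : G, (∃ i j k : ℕ, g = a ^ i * b ^ j * z ^ k) →
        (∃ i j k : ℕ, b * g = a ^ i * b ^ j * z ^ k) := by
      rintro _ ⟨i, j, k, rfl⟩
      refine ⟨i, j + 1, k + 2 * i, ?_⟩
      have h1 : b * a ^ i = z ^ (2 * i) * (a ^ i * b) := by
        have := hP i 1
        simp only [mul_one, pow_one] at this
        rw [this, ← mul_assoc, ← pow_add, show 2 * i + i = 3 * i by ring, pow_mul, hz3]; simp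
      have h2 : ∀ g, g * z ^ (2 * i) = z ^ (2 * i) * g := fun g =>
        ((show Commute g z from hz g).pow_right _).eq
      rw [add_comm k, pow_add z, ← mul_assoc (a ^ i * b ^ (j + 1)), h2, pow_succ' b]
      calc _ = (b * a ^ i) * b ^ j * z ^ k := by group
        _ = _ := by rw [h1]; group
    intro g
    have hg : g ∈ Subgroup.closure {a, b} := by rw [hcl]; trivial
    have hai : a⁻¹ = a * a := by
      apply inv_eq_of_mul_eq_one_left; rw [← ha]; simp only [pow_succ, pow_zero, one_mul]
    have hbi : b⁻¹ = b * b := by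
      apply inv_eq_of_mul_eq_one_left; rw [← hb]; simp only [pow_succ, pow_zero, one_mul]
    induction hg using Subgroup.closure_induction_left with
    | one => exact ⟨0, 0, 0, by simp⟩
    | mul_left x hx y hy ih =>
      rcases hx with rfl | rfl
      · exact hA _ ih
      · exact hB _ ih
    | inv_mul_cancel x hx y hy ih =>
      rcases hx with rfl | rfl
      · rw [hai, mul_assoc]; exact hA _ (hA _ ih)
      · rw [hbi, mul_assoc]; exact hB _ (hB _ ih)
  constructor
  · have hsurj : Function.Surjective
        (fun p : Fin 3 × Fin 3 × Fin 3 => a ^ (p.1 : ℕ) * b ^ (p.2.1 : ℕ) * z ^ (p.2.2 : ℕ)) := by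
      intro g
      obtain ⟨i, j, k, rfl⟩ := hall g
      refine ⟨(⟨i % 3, Nat.mod_lt _ (by norm_num)⟩, ⟨j % 3, Nat.mod_lt _ (by norm_num)⟩,
        ⟨k % 3, Nat.mod_lt _ (by norm_num)⟩), ?_⟩
      simp only
      rw [← pow_eq_pow_mod i ha, ← pow_eq_pow_mod j hb, ← pow_eq_pow_mod k hz3]
    have hle := Nat.card_le_card_of_surjective _ hsurj
    simp only [Nat.card_eq_fintype_card, Fintype.card_prod, Fintype.card_fin] at hle
    obtain ⟨n, hn⟩ := IsPGroup.iff_card.1 hp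
    have hn3 : n ≤ 3 := by
      by_contra hlt
      have : 3 ^ 4 ≤ 3 ^ n := Nat.pow_le_pow_right (by norm_num) (by omega)
      omega
    rcases Nat.lt_or_ge n 3 with hlt | hge
    · exfalso
      apply hna
      interval_cases n
      · have := (Nat.card_eq_one_iff_unique.1 hn).1
        intro a b; exact Subsingleton.elim _ _
      · have := isCyclic_of_prime_card (p := 3) (by simpa using hn)
        have := IsCyclic.isMulCommutative (α := G)
        exact fun a b => mul_comm' a b
      · have := IsPGroup.isMulCommutative_of_card_eq_prime_sq hn
        exact fun a b => mul_comm' a b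
    · have : n = 3 := by omega
      rw [hn, this]; norm_num
  · intro g
    obtain ⟨i, j, k, rfl⟩ := hall g
    have hzk : Commute (a ^ i * b ^ j) (z ^ k) :=
      (show Commute (a ^ i * b ^ j) z from hz _).pow_right k
    rw [hzk.mul_pow, aux_cube (a ^ i) (b ^ j) (z ^ (i * j)) (hP i j)
      (fun g => ((show Commute g z from hz g).pow_right _).eq)
      (by rw [← pow_mul, mul_comm, pow_mul, hz3, one_pow])]
    rw [← pow_mul, ← pow_mul, ← pow_mul, mul_comm i, mul_comm j, mul_comm k, pow_mul, pow_mul,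
      pow_mul, ha, hb, hz3]
    simp

theorem aux_central {G : Type*} [Group G] (a b g : G) (hcl : Subgroup.closure {a, b} = ⊤)
    (ha : Commute a g) (hb : Commute b g) : g ∈ Subgroup.center G := by
  have : (⊤ : Subgroup G) ≤ Subgroup.centralizer {g} := by
    rw [← hcl, Subgroup.closure_le]
    rintro u (rfl | rfl)
    · exact Subgroup.mem_centralizer_singleton_iff.2 ha.eq
    · exact Subgroup.mem_centralizer_singleton_iff.2 hb.eq
  rw [Subgroup.mem_center_iff]
  intro u
  exact Subgroup.mem_centralizer_singleton_iff.1 (this (Subgroup.mem_top u))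

theorem aux_caseB0 {G : Type*} [Group G] [Finite G] (hp : IsPGroup 3 G)
    (hgen : ∀ a b : G, a * b ≠ b * a → Subgroup.closure {a, b} = ⊤)
    (hcyc : IsCyclic (Subgroup.center G)) (x y z : G) (h : x * y = z * (y * x))
    (hz : ∀ g, g * z = z * g) (hz1 : z ≠ 1) (hz3 : z ^ 3 = 1)
    (hx3 : x ^ 3 ∈ Subgroup.center G) (hy3 : y ^ 3 ∈ Subgroup.center G)
    (hx : ¬ ∃ c ∈ Subgroup.center G, x ^ 3 = c ^ 3) :
    ∃ k : ℕ, 2 ≤ k ∧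
      ∃ φ : Multiplicative (ZMod 3) →* MulAut (Multiplicative (ZMod (3 ^ k))),
        (∀ a : Multiplicative (ZMod (3 ^ k)),
          φ (Multiplicative.ofAdd 1) a = a ^ (1 + 3 ^ (k - 1))) ∧
        Nonempty (G ≃* (Multiplicative (ZMod (3 ^ k)) ⋊[φ] Multiplicative (ZMod 3))) := by
  have : Fact (Nat.Prime 3) := ⟨by norm_num⟩
  have hZ : ∀ c ∈ Subgroup.center G, ∃ i : ℕ, c = (x ^ 3) ^ i := by
    obtain ⟨⟨g, hgc⟩, hg⟩ := hcyc.exists_generator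
    have hg' : ∀ c ∈ Subgroup.center G, ∃ n : ℤ, g ^ n = c := by
      intro c hc
      obtain ⟨n, hn⟩ := Subgroup.mem_zpowers_iff.1 (hg ⟨c, hc⟩)
      exact ⟨n, congrArg Subtype.val hn⟩
    obtain ⟨n, hn⟩ := hg' _ hx3
    have hn3 : ¬ (3 : ℤ) ∣ n := by
      rintro ⟨m, rfl⟩
      apply hx
      refine ⟨g ^ m, Subgroup.zpow_mem _ hgc _, ?_⟩
      rw [← hn, mul_comm, zpow_mul]; norm_cast
    obtain ⟨l, hl⟩ := hp g
    have hco : IsCoprime n ((3 : ℤ) ^ l) := by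
      apply IsCoprime.pow_right
      exact ((Int.prime_three.coprime_iff_not_dvd).2 hn3).symm
    obtain ⟨u, v, huv⟩ := hco
    have hgx : g = (x ^ 3) ^ u := by
      rw [← hn, ← zpow_mul]
      conv_lhs => rw [← zpow_one g, ← huv, zpow_add, mul_comm v, zpow_mul g (3 ^ l)]
      have : g ^ ((3 : ℤ) ^ l) = 1 := by exact_mod_cast hl
      rw [this, one_zpow, mul_one, mul_comm]
    intro c hc
    obtain ⟨m, hm⟩ := hg' c hc
    have : c ∈ Subgroup.zpowers (x ^ 3) := by
      rw [← hm, hgx]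
      exact Subgroup.zpow_mem _ (Subgroup.zpow_mem _ (Subgroup.mem_zpowers _) _) _
    rw [← mem_powers_iff_mem_zpowers] at this
    obtain ⟨i, hi⟩ := this
    exact ⟨i, hi.symm⟩
  obtain ⟨j, hj⟩ := hZ _ (Subgroup.inv_mem _ hy3)
  have hzi : ∀ g, g * z⁻¹ = z⁻¹ * g := fun g => ((show Commute g z from hz g).inv_right).eq
  have hyx : y * x = z⁻¹ * (x * y) := by rw [h]; group
  obtain ⟨w, hw⟩ : ∃ w, w = y * x ^ j := ⟨_, rfl⟩
  have hw3 : w ^ 3 = 1 := by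
    have := aux_pow y x z⁻¹ hyx hzi 1 j
    simp only [pow_one, one_mul] at this
    rw [hw, aux_cube y (x ^ j) (z⁻¹ ^ j) this
      (fun g => ((show Commute g z⁻¹ from hzi g).pow_right _).eq)
      (by rw [← pow_mul, mul_comm, pow_mul, inv_pow, hz3]; simp), ← pow_mul, mul_comm j, pow_mul,
      ← hj]
    simp
  have hxw : x * w = z * (w * x) := by
    rw [hw, ← mul_assoc, h]
    simp only [mul_assoc]
    rw [← pow_succ, ← pow_succ']
  have hne : w * x ≠ x * w := by
    intro he
    rw [hxw] at he
    exact hz1 (mul_eq_right.1 he.symm)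
  obtain ⟨k, hk⟩ := IsPGroup.iff_orderOf.1 hp x
  obtain ⟨i, hi⟩ := hZ z (Subgroup.mem_center_iff.2 hz)
  rcases k with _ | _ | k
  · rw [pow_zero, orderOf_eq_one_iff] at hk
    rw [hk] at hi; simp at hi; exact absurd hi hz1
  · have : x ^ 3 = 1 := by rw [← pow_orderOf_eq_one x, hk]; simp
    rw [this] at hi; simp at hi; exact absurd hi hz1
  refine ⟨k + 2, by omega, ?_⟩
  simp only [Nat.add_succ_sub_one]
  obtain ⟨p, hpdef⟩ : ∃ p, p = x ^ (3 ^ (k + 1)) := ⟨_, rfl⟩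
  have hp3 : p ^ 3 = 1 := by
    rw [hpdef, ← pow_mul, ← pow_succ, ← hk]; exact pow_orderOf_eq_one x
  have hzp : z = p ∨ z = p ^ 2 := by
    have hd : 3 ^ (k + 2) ∣ 9 * i := by
      rw [← hk]
      apply orderOf_dvd_of_pow_eq_one
      rw [← hz3, hi]
      simp only [← pow_mul]
      congr 1; ring
    obtain ⟨i', hi'⟩ : 3 ^ k ∣ i := by
      rw [pow_add, mul_comm] at hd
      exact Nat.dvd_of_mul_dvd_mul_left (by norm_num : 0 < 9) hd
    have hzpi : z = p ^ (i' % 3) := by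
      rw [← pow_eq_pow_mod i' hp3, hpdef, hi, hi', ← pow_mul, ← pow_mul]
      congr 1; ring
    have : i' % 3 < 3 := Nat.mod_lt _ (by norm_num)
    interval_cases i' % 3
    · exact absurd (by simpa using hzpi) hz1
    · left; simpa using hzpi
    · right; exact hzpi
  have hpx : x ^ (1 + 3 ^ (k + 1)) = p * x := by
    rw [add_comm, pow_succ, hpdef]
  rcases hzp with hzp | hzp
  · have hne' : w⁻¹ * x ≠ x * w⁻¹ := by
      intro he
      have : Commute w⁻¹ x := he
      exact hne (by simpa using this.inv_left.eq)
    refine aux_caseB k x w⁻¹ hk (by rw [inv_pow, hw3, inv_one]) ?_ hne' (hgen _ _ hne'.symm)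
    rw [hpx, ← hzp]
    have : w⁻¹ * x = w⁻¹ * (x * w) * w⁻¹ := by group
    rw [this, hxw, ← mul_assoc, hz]; group
  · refine aux_caseB k x w hk hw3 ?_ hne (hgen _ _ hne.symm)
    rw [hpx, mul_assoc, hxw, hzp, ← mul_assoc, ← pow_succ', hp3, one_mul]

theorem stmt_18 (G : Type*) [Group G] [Finite G] (hp : IsPGroup 3 G)
    (hna : ¬ ∀ a b : G, a * b = b * a) (h : MinFaithful G 3) :
    (Nat.card G = 27 ∧ ∀ g : G, g ^ 3 = 1) ∨
    ∃ k : ℕ, 2 ≤ k ∧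
      ∃ φ : Multiplicative (ZMod 3) →* MulAut (Multiplicative (ZMod (3 ^ k))),
        (∀ a : Multiplicative (ZMod (3 ^ k)),
          φ (Multiplicative.ofAdd 1) a = a ^ (1 + 3 ^ (k - 1))) ∧
        Nonempty (G ≃* (Multiplicative (ZMod (3 ^ k)) ⋊[φ] Multiplicative (ZMod 3))) := by
  obtain ⟨hG, hH⟩ := h
  have hmem : ∃ ρ : G →* GL (Fin 3) ℂ, Function.Injective ρ := by
    have hne : {n : ℕ | ∃ ρ : G →* GL (Fin n) ℂ, Function.Injective ρ}.Nonempty := by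
      apply Nat.nonempty_of_pos_sInf
      change 0 < rdim G
      omega
    have := Nat.sInf_mem hne
    change rdim G ∈ _ at this
    rw [hG] at this
    exact this
  obtain ⟨ρ, hρ⟩ := hmem
  have hgen : ∀ a b : G, a * b ≠ b * a → Subgroup.closure {a, b} = ⊤ := by
    intro a b hab
    by_contra hne
    have hlt := hH _ hne
    obtain ⟨ρ', hρ'⟩ : rdim (Subgroup.closure {a, b}) ∈
        {n : ℕ | ∃ ρ : (Subgroup.closure {a, b}) →* GL (Fin n) ℂ, Function.Injective ρ} :=
      Nat.sInf_mem ⟨3, ρ.comp (Subgroup.subtype _), hρ.comp (Subgroup.subtype_injective _)⟩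
    have := aux_abel (hp.to_subgroup _) (by omega) ρ' hρ'
      ⟨a, Subgroup.subset_closure (by simp)⟩ ⟨b, Subgroup.subset_closure (by simp)⟩
    exact hab (congrArg Subtype.val this)
  obtain ⟨x, y, z, h, hz, hz1, hz3, hcyc⟩ := aux_facts hp hna ρ hρ
  have hne : x * y ≠ y * x := by
    intro he
    rw [h] at he
    exact hz1 (mul_eq_right.1 he)
  have hzi : ∀ g, g * z⁻¹ = z⁻¹ * g := fun g => ((show Commute g z from hz g).inv_right).eq
  have hyx : y * x = z⁻¹ * (x * y) := by rw [h]; group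
  have hcl := hgen x y hne
  have hx3 : x ^ 3 ∈ Subgroup.center G := by
    apply aux_central x y _ hcl ((Commute.refl x).pow_right 3)
    have := aux_pow x y z h hz 3 1
    simp only [mul_one, pow_one, hz3, one_mul] at this
    exact this.symm
  have hy3 : y ^ 3 ∈ Subgroup.center G := by
    apply aux_central x y _ hcl _ ((Commute.refl y).pow_right 3)
    have := aux_pow x y z h hz 1 3
    simp only [one_mul, pow_one, hz3] at this
    exact this
  by_cases hxc : ∃ c ∈ Subgroup.center G, x ^ 3 = c ^ 3
  · by_cases hyc : ∃ c ∈ Subgroup.center G, y ^ 3 = c ^ 3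
    · left
      obtain ⟨c, hc, hc3⟩ := hxc
      obtain ⟨d, hd, hd3⟩ := hyc
      have hci : ∀ g, g * c⁻¹ = c⁻¹ * g := Subgroup.mem_center_iff.1 (Subgroup.inv_mem _ hc)
      have hdi : ∀ g, g * d⁻¹ = d⁻¹ * g := Subgroup.mem_center_iff.1 (Subgroup.inv_mem _ hd)
      have h1 : (c⁻¹ * x) * (d⁻¹ * y) = c⁻¹ * d⁻¹ * (x * y) := by
        rw [mul_assoc, ← mul_assoc x, hdi x]; group
      have h2 : (d⁻¹ * y) * (c⁻¹ * x) = c⁻¹ * d⁻¹ * (y * x) := by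
        rw [mul_assoc, ← mul_assoc y, hci y, hdi c⁻¹]; group
      have h3 : (c⁻¹ * x) * (d⁻¹ * y) = z * ((d⁻¹ * y) * (c⁻¹ * x)) := by
        rw [h1, h2, h, ← mul_assoc, hz]; group
      refine aux_caseA hp hna (c⁻¹ * x) (d⁻¹ * y) z h3 hz hz3 ?_ ?_ (hgen _ _ ?_)
      · rw [(show Commute c⁻¹ x from (hci x).symm).mul_pow, hc3]; simp
      · rw [(show Commute d⁻¹ y from (hdi y).symm).mul_pow, hd3]; simp
      · rw [h1, h2]
        intro he
        exact hne (mul_left_cancel he)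
    · right
      exact aux_caseB0 hp hgen hcyc y x z⁻¹ hyx hzi (by simpa using hz1) (by simp [hz3]) hy3 hx3 hyc
  · right
    exact aux_caseB0 hp hgen hcyc x y z h hz hz1 hz3 hx3 hy3 hxc
end

section
/- Let G be a finite nonabelian group of odd order that is not a 3-group and is minimally faithful of degree 3. Then there exist a prime p ≥ 5 and an integer n ≥ 1 such that either (a) p ≡ 1 (mod 3) and G is isomorphic to a semidirect product C_p ⋊ C_{3^n} whose center is cyclic of order 3^{n-1}, or (b) p ≡ 2 (mod 3) and G is isomorphic to a semidirect product (C_p × C_p) ⋊ C_{3^n} whose center is cyclic of order 3^{n-1}. -/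
theorem weights_aux {G : Type*} [Group G] [Finite G] {V : Type*} [AddCommGroup V] [Module ℂ V]
    [FiniteDimensional ℂ V] (ρ : G →* Module.End ℂ V) (hρ : Function.Injective ρ)
    (K : Subgroup G) [K.Normal] (hK : ∀ a ∈ K, ∀ b ∈ K, a * b = b * a) (x : G) :
    ∀ k ∈ K, x ^ (Nat.gcd (Module.finrank ℂ V).factorial (orderOf x)) * k
      = k * x ^ (Nat.gcd (Module.finrank ℂ V).factorial (orderOf x)) := by
  classical
  have hcomm : ∀ i j : K, Commute (ρ i) (ρ j) := fun i j => by
    change ρ i * ρ j = ρ j * ρ i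
    rw [← map_mul, ← map_mul, hK i i.2 j j.2]
  have hss : ∀ i : K, (ρ (i : G)).IsSemisimple := fun i => by
    have hn : orderOf (i : G) ≠ 0 := (orderOf_pos _).ne'
    refine Module.End.isSemisimple_of_squarefree_aeval_eq_zero
      (p := Polynomial.X ^ (orderOf (i : G)) - Polynomial.C 1) ?_ ?_
    · exact (Polynomial.separable_X_pow_sub_C (1 : ℂ) (by exact_mod_cast hn) one_ne_zero).squarefree
    · rw [map_sub, map_pow, Polynomial.aeval_X, Polynomial.aeval_C, ← map_pow, pow_orderOf_eq_one]
      simp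
  let W : (K → ℂ) → Submodule ℂ V := fun χ => ⨅ i : K, (ρ (i : G)).eigenspace (χ i)
  have hWeq : (fun χ : K → ℂ => ⨅ i : K, (ρ (i : G)).maxGenEigenspace (χ i)) = W := by
    funext χ
    exact iInf_congr fun i => (hss i).isFinitelySemisimple.maxGenEigenspace_eq_eigenspace _
  have hind : iSupIndep W := by
    rw [← hWeq]
    exact Module.End.independent_iInf_maxGenEigenspace_of_forall_mapsTo (fun i : K => ρ (i : G))
      (fun i j φ => Module.End.mapsTo_maxGenEigenspace_of_comm (hcomm j i) φ)
  have htop : ⨆ χ, W χ = ⊤ := by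
    rw [← hWeq]
    exact Module.End.iSup_iInf_maxGenEigenspace_eq_top_of_forall_mapsTo (fun i : K => ρ (i : G))
      (fun i j φ => Module.End.mapsTo_maxGenEigenspace_of_comm (hcomm j i) φ)
      (fun i => Module.End.iSup_maxGenEigenspace_eq_top _)
  have hmemW : ∀ χ v, v ∈ W χ ↔ ∀ i : K, ρ (i : G) v = χ i • v := fun χ v => by
    simp [W, Submodule.mem_iInf]
  -- the permutation
  let e : G → Equiv.Perm (K → ℂ) := fun g =>
    Equiv.arrowCongr (MulAut.conjNormal g : MulAut K).toEquiv (Equiv.refl ℂ)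
  have he : ∀ g χ (i : K), e g χ i = χ ((MulAut.conjNormal g : MulAut K).symm i) := fun g χ i => rfl
  have hepow : ∀ g (n : ℕ), e g ^ n = e (g ^ n) := by
    intro g n
    induction n with
    | zero =>
      ext χ i
      rw [he]
      simp only [pow_zero, Equiv.Perm.coe_one, id_eq]
      congr 1
      apply Subtype.ext
      simp [MulAut.conjNormal_symm_apply, -map_one]
    | succ n ih =>
      ext χ i
      rw [pow_succ, ih, Equiv.Perm.mul_apply, he, he, he]
      congr 1
      apply Subtype.ext
      rw [MulAut.conjNormal_symm_apply, MulAut.conjNormal_symm_apply, MulAut.conjNormal_symm_apply]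
      group
  have hWe1 : ∀ g χ v, v ∈ W χ → ρ g v ∈ W (e g χ) := by
    intro g χ v hv
    rw [hmemW] at hv ⊢
    intro i
    have h1 := hv ((MulAut.conjNormal g : MulAut K).symm i)
    rw [he, ← map_smul, ← h1, ← Module.End.mul_apply, ← Module.End.mul_apply, ← map_mul, ← map_mul]
    congr 2
    rw [MulAut.conjNormal_symm_apply]; group
  have hone : ∀ g v, ρ g⁻¹ (ρ g v) = v := fun g v => by
    rw [← Module.End.mul_apply, ← map_mul]; simp
  have hWe : ∀ χ, W χ ≠ ⊥ → W (e x χ) ≠ ⊥ := by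
    intro χ h h'
    apply h
    rw [eq_bot_iff]
    intro v hv
    have := hWe1 x χ v hv
    rw [h', Submodule.mem_bot] at this
    rw [Submodule.mem_bot, ← hone x v, this, map_zero]
  have hfinS : Finite {χ // W χ ≠ ⊥} := WellFoundedGT.finite_ne_bot_of_iSupIndep hind
  let _ := Fintype.ofFinite {χ // W χ ≠ ⊥}
  have hcard := hind.subtype_ne_bot_le_finrank
  let f : {χ // W χ ≠ ⊥} → {χ // W χ ≠ ⊥} := fun s => ⟨e x s.1, hWe _ s.2⟩
  have hf : Function.Injective f := fun a b h => Subtype.ext ((e x).injective (congrArg Subtype.val h))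
  let τ : Equiv.Perm {χ // W χ ≠ ⊥} := Equiv.ofBijective f (Finite.injective_iff_bijective.1 hf)
  have hτ : ∀ n s, ((τ ^ n) s).1 = e (x ^ n) s.1 := by
    intro n s
    rw [← hepow]
    induction n with
    | zero => rfl
    | succ n ih => rw [pow_succ', pow_succ', Equiv.Perm.mul_apply, Equiv.Perm.mul_apply, ← ih]; rfl
  have h1 : orderOf τ ∣ orderOf x := by
    apply orderOf_dvd_of_pow_eq_one
    ext s : 2
    rw [hτ, pow_orderOf_eq_one]
    ext i
    rw [he]
    simp only [Equiv.Perm.coe_one, id_eq]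
    refine congrArg s.1 (Subtype.ext ?_)
    simp [MulAut.conjNormal_symm_apply, -map_one]
  have h2 : orderOf τ ∣ (Module.finrank ℂ V).factorial := by
    refine (orderOf_dvd_card).trans ?_
    rw [Fintype.card_perm]
    exact Nat.factorial_dvd_factorial hcard
  set d := Nat.gcd (Module.finrank ℂ V).factorial (orderOf x) with hd
  have h3 : τ ^ d = 1 := orderOf_dvd_iff_pow_eq_one.1 (Nat.dvd_gcd h2 h1)
  intro k hk
  have h4 : ∀ χ, W χ ≠ ⊥ → ∀ i, e (x ^ d) χ i = χ i := fun χ h i => by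
    rw [← hτ d ⟨χ, h⟩, h3]; rfl
  have h5 : ρ k = ρ ((MulAut.conjNormal (x ^ d) : MulAut K).symm ⟨k, hk⟩ : K) := by
    apply LinearMap.ext
    intro v
    have : v ∈ ⨆ χ, W χ := htop ▸ Submodule.mem_top
    induction this using Submodule.iSup_induction' with
    | mem χ v hv =>
      by_cases hb : W χ = ⊥
      · rw [hb, Submodule.mem_bot] at hv
        simp [hv]
      · have hv' := (hmemW χ v).1 hv
        rw [hv' ⟨k, hk⟩, hv', ← h4 χ hb ⟨k, hk⟩, he]
    | zero => simp
    | add a b _ _ ha hb => rw [map_add, map_add, ha, hb]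
  have h6 := hρ h5
  rw [MulAut.conjNormal_symm_apply] at h6
  change k = (x ^ d)⁻¹ * k * x ^ d at h6
  nth_rewrite 1 [h6]
  group

theorem weights_gl {G : Type*} [Group G] [Finite G] {n : ℕ} (ρ : G →* GL (Fin n) ℂ)
    (hρ : Function.Injective ρ)
    (K : Subgroup G) [K.Normal] (hK : ∀ a ∈ K, ∀ b ∈ K, a * b = b * a) (x : G) :
    ∀ k ∈ K, x ^ (Nat.gcd n.factorial (orderOf x)) * k
      = k * x ^ (Nat.gcd n.factorial (orderOf x)) := by
  let ρ' : G →* Module.End ℂ (Fin n → ℂ) :=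
    ((Matrix.toLinAlgEquiv' (R := ℂ) (n := Fin n) : _ →* _).comp
      (Units.coeHom (Matrix (Fin n) (Fin n) ℂ))).comp ρ
  have h : Function.Injective ρ' := by
    intro a b hab
    exact hρ (Units.ext ((Matrix.toLinAlgEquiv' (R := ℂ) (n := Fin n)).injective hab))
  simpa using weights_aux ρ' h K hK x

theorem odd_orderOf {G : Type*} [Group G] [Finite G] (hodd : Odd (Nat.card G)) (x : G) :
    Odd (orderOf x) := hodd.of_dvd_nat (orderOf_dvd_natCard x)

theorem weights_two {G : Type*} [Group G] [Finite G] (hodd : Odd (Nat.card G)) {n : ℕ} (hn : n ≤ 2)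
    (ρ : G →* GL (Fin n) ℂ) (hρ : Function.Injective ρ)
    (K : Subgroup G) [K.Normal] (hK : ∀ a ∈ K, ∀ b ∈ K, a * b = b * a) (x : G) :
    ∀ k ∈ K, x * k = k * x := by
  have h1 : Nat.gcd n.factorial (orderOf x) = 1 := by
    refine Nat.Coprime.coprime_dvd_left (Nat.factorial_dvd_factorial hn) ?_
    simpa using odd_orderOf hodd x
  have := weights_gl ρ hρ K hK x
  rwa [h1, pow_one] at this

theorem weights_three {G : Type*} [Group G] [Finite G] (hodd : Odd (Nat.card G))
    (ρ : G →* GL (Fin 3) ℂ) (hρ : Function.Injective ρ)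
    (K : Subgroup G) [K.Normal] (hK : ∀ a ∈ K, ∀ b ∈ K, a * b = b * a) (x : G) :
    ∀ k ∈ K, Commute (x ^ 3) k := by
  have h1 : Nat.gcd (Nat.factorial 3) (orderOf x) ∣ 3 := by
    have h2 : (orderOf x).Coprime 2 := (Nat.coprime_two_right).2 (odd_orderOf hodd x)
    have h3 : Nat.gcd (Nat.factorial 3) (orderOf x) ∣ 2 * 3 := Nat.gcd_dvd_left _ _
    exact Nat.Coprime.dvd_of_dvd_mul_left (h2.coprime_dvd_left (Nat.gcd_dvd_right _ _)) h3
  intro k hk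
  obtain ⟨c, hc⟩ := h1
  rw [hc, pow_mul]
  exact Commute.pow_left (weights_gl ρ hρ K hK x k hk) c

theorem weights_three' {G : Type*} [Group G] [Finite G] (hodd : Odd (Nat.card G))
    (ρ : G →* GL (Fin 3) ℂ) (hρ : Function.Injective ρ)
    (K : Subgroup G) [K.Normal] (hK : ∀ a ∈ K, ∀ b ∈ K, a * b = b * a) (x : G)
    (hx : ¬ 3 ∣ orderOf x) :
    ∀ k ∈ K, x * k = k * x := by
  intro k hk
  have h1 := weights_three hodd ρ hρ K hK x k hk
  have h2 : (orderOf x).Coprime 3 := ((Nat.Prime.coprime_iff_not_dvd Nat.prime_three).2 hx).symm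
  obtain ⟨m, hm⟩ := exists_pow_eq_self_of_coprime h2.symm
  rw [← hm]
  exact h1.pow_left m

theorem comm_of_sup {G : Type*} [Group G] (A B : Subgroup G) (h : A ⊔ B = ⊤)
    (hA : ∀ a ∈ A, ∀ b ∈ A, a * b = b * a) (hB : ∀ a ∈ B, ∀ b ∈ B, a * b = b * a)
    (hAB : ∀ a ∈ A, ∀ b ∈ B, a * b = b * a) : ∀ a b : G, a * b = b * a := by
  have h1 : A ≤ Subgroup.center G := by
    have : A ⊔ B ≤ Subgroup.centralizer (A : Set G) := sup_le
      (fun a ha => Subgroup.mem_centralizer_iff.2 fun b hb => hA b hb a ha)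
      (fun a ha => Subgroup.mem_centralizer_iff.2 fun b hb => hAB b hb a ha)
    intro a ha
    rw [Subgroup.mem_center_iff]
    intro g
    exact (Subgroup.mem_centralizer_iff.1 (this (h ▸ Subgroup.mem_top g)) a ha).symm
  have h2 : B ≤ Subgroup.center G := by
    have : A ⊔ B ≤ Subgroup.centralizer (B : Set G) := sup_le
      (fun a ha => Subgroup.mem_centralizer_iff.2 fun b hb => (hAB a ha b hb).symm)
      (fun a ha => Subgroup.mem_centralizer_iff.2 fun b hb => hB b hb a ha)
    intro a ha
    rw [Subgroup.mem_center_iff]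
    intro g
    exact (Subgroup.mem_centralizer_iff.1 (this (h ▸ Subgroup.mem_top g)) a ha).symm
  intro a b
  have : b ∈ Subgroup.center G := sup_le h1 h2 (h ▸ Subgroup.mem_top b)
  exact Subgroup.mem_center_iff.1 this a

theorem burnside_split {G : Type*} [Group G] [Finite G]
    (hab : ∀ H : Subgroup G, H ≠ ⊤ → ∀ a ∈ H, ∀ b ∈ H, a * b = b * a)
    {q : ℕ} [Fact q.Prime] (P : Sylow q G) (hP : ¬ (P : Subgroup G).Normal) :
    ∃ K : Subgroup G, K.Normal ∧ K.IsComplement' P ∧ ¬ q ∣ Nat.card K ∧ K ≠ ⊤ ∧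
      (P : Subgroup G) ≠ ⊤ := by
  have hN : Subgroup.normalizer (P : Set G) ≠ ⊤ := fun h => hP (Subgroup.normalizer_eq_top_iff.1 h)
  have hle : Subgroup.normalizer (P : Set G) ≤ Subgroup.centralizer (P : Set G) := by
    intro g hg
    rw [Subgroup.mem_centralizer_iff]
    intro a ha
    exact hab _ hN a (Subgroup.le_normalizer ha) g hg
  have hc := MonoidHom.ker_transferSylow_isComplement' P hle
  refine ⟨_, inferInstance, hc, MonoidHom.not_dvd_card_ker_transferSylow P hle, ?_, ?_⟩
  · intro h
    rw [h] at hc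
    have := Subgroup.isComplement'_top_left.1 hc
    exact hP (by rw [this]; infer_instance)
  · intro h
    exact hP (by rw [h]; infer_instance)

theorem comm_of_coatom {G : Type*} [Group G] (M : Subgroup G) (hM : IsCoatom M)
    (hz : ∀ x, ∀ k ∈ M, x * k = k * x) : ∀ a b : G, a * b = b * a := by
  obtain ⟨x, hx⟩ : ∃ x, x ∉ M := by
    by_contra! h
    exact hM.1 (eq_top_iff.2 fun x _ => h x)
  refine comm_of_sup M (Subgroup.zpowers x) (hM.2 _ ?_) (fun a _ b hb => hz a b hb) ?_
    (fun a ha b _ => (hz b a ha).symm)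
  · refine lt_of_le_of_ne le_sup_left fun h => hx ?_
    rw [h]
    exact Subgroup.mem_sup_right (Subgroup.mem_zpowers x)
  · rintro _ ⟨i, rfl⟩ _ ⟨j, rfl⟩
    exact ((Commute.refl x).zpow_zpow i j).eq

theorem comm_of_two : ∀ (N : ℕ) (G : Type*) [Group G] [Finite G] (_ : Nat.card G = N)
    (_ : Odd (Nat.card G)) {n : ℕ} (_ : n ≤ 2)
    (ρ : G →* GL (Fin n) ℂ) (_ : Function.Injective ρ), ∀ a b : G, a * b = b * a := by
  intro N
  induction N using Nat.strong_induction_on with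
  | _ N ih =>
  intro G _ _ hN hodd n hn ρ hρ
  have hab : ∀ H : Subgroup G, H ≠ ⊤ → ∀ a ∈ H, ∀ b ∈ H, a * b = b * a := by
    intro H hH a ha b hb
    have hlt : Nat.card H < N := by
      rw [← hN]
      refine lt_of_le_of_ne (Subgroup.card_le_card_group H) fun h => hH ?_
      exact Subgroup.eq_top_of_card_eq H h
    have := ih _ hlt H rfl (hodd.of_dvd_nat (Subgroup.card_subgroup_dvd_card H)) hn
      (ρ.comp H.subtype) (hρ.comp H.subtype_injective) ⟨a, ha⟩ ⟨b, hb⟩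
    exact congrArg Subtype.val this
  by_cases hnil : Group.IsNilpotent G
  · rcases subsingleton_or_nontrivial G with hs | hs
    · intro a b; exact Subsingleton.elim _ _
    have h2 := ((Group.isNilpotent_of_finite_tfae (G := G)).out 0 2).1 hnil
    obtain ⟨M, hM, -⟩ := (eq_top_or_exists_le_coatom (⊥ : Subgroup G)).resolve_left bot_ne_top
    have := h2 M hM
    exact comm_of_coatom M hM fun x => weights_two hodd hn ρ hρ M (hab M hM.1) x
  · replace hnil := (not_congr ((Group.isNilpotent_of_finite_tfae (G := G)).out 0 3)).1 hnil
    push Not at hnil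
    obtain ⟨q, hq, P, hP⟩ := hnil
    obtain ⟨K, hK1, hK2, hK3, hK4, hP4⟩ := burnside_split hab P hP
    exact comm_of_sup K P hK2.sup_eq_top (hab K hK4) (hab _ hP4)
      (fun a ha b _ => (weights_two hodd hn ρ hρ K (hab K hK4) b a ha).symm)

/-- A non-nilpotent configuration. -/
theorem main_split {G : Type*} [Group G] [Finite G]
    (hna : ¬ ∀ a b : G, a * b = b * a) (hodd : Odd (Nat.card G))
    (h3 : ¬ IsPGroup 3 G) (ρ : G →* GL (Fin 3) ℂ) (hρ : Function.Injective ρ)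
    (hab : ∀ H : Subgroup G, H ≠ ⊤ → ∀ a ∈ H, ∀ b ∈ H, a * b = b * a) :
    ∃ (K : Subgroup G) (x : G) (n : ℕ), K.Normal ∧ K.IsComplement' (Subgroup.zpowers x) ∧
      ¬ 3 ∣ Nat.card K ∧ K ≠ ⊤ ∧ orderOf x = 3 ^ n ∧ (∃ k ∈ K, x * k ≠ k * x) ∧
      ∀ k ∈ K, Commute (x ^ 3) k := by
  by_cases hnil : Group.IsNilpotent G
  · exfalso
    by_cases hp : ∃ p, p.Prime ∧ IsPGroup p G
    · obtain ⟨p, hp, hpG⟩ := hp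
      rcases subsingleton_or_nontrivial G with hs | hs
      · exact hna fun a b => Subsingleton.elim _ _
      have h2 := ((Group.isNilpotent_of_finite_tfae (G := G)).out 0 2).1 hnil
      obtain ⟨M, hM, -⟩ := (eq_top_or_exists_le_coatom (⊥ : Subgroup G)).resolve_left bot_ne_top
      have := h2 M hM
      refine hna (comm_of_coatom M hM fun x =>
        weights_three' hodd ρ hρ M (hab M hM.1) x fun h => h3 ?_)
      have : Fact p.Prime := ⟨hp⟩
      obtain ⟨k, hk⟩ := IsPGroup.iff_orderOf.1 hpG x
      rw [hk] at h
      have := (Nat.prime_dvd_prime_iff_eq Nat.prime_three hp).1 (Nat.prime_three.dvd_of_dvd_pow h)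
      exact this ▸ hpG
    · obtain ⟨φ⟩ := ((Group.isNilpotent_of_finite_tfae (G := G)).out 0 4).1 hnil
      apply hna
      intro a b
      apply φ.symm.injective
      rw [map_mul, map_mul]
      ext p P
      have hp' : (p : ℕ).Prime := Nat.prime_of_mem_primeFactors p.2
      refine hab (P : Subgroup G) (fun h => hp ⟨p, hp', ?_⟩) _ (SetLike.coe_mem _) _
        (SetLike.coe_mem _)
      have := P.isPGroup'
      rw [h] at this
      exact this.of_equiv Subgroup.topEquiv
  · replace hnil := (not_congr ((Group.isNilpotent_of_finite_tfae (G := G)).out 0 3)).1 hnil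
    push Not at hnil
    obtain ⟨q, hq, P, hP⟩ := hnil
    obtain ⟨K, hK1, hK2, hK3, hK4, hP4⟩ := burnside_split hab P hP
    have hPK : ∃ x ∈ P, ∃ k ∈ K, x * k ≠ k * x := by
      by_contra! h
      exact hna (comm_of_sup K P hK2.sup_eq_top (hab K hK4) (hab _ hP4)
        fun a ha b hb => (h b hb a ha).symm)
    obtain ⟨x, hx, k, hk, hxk⟩ := hPK
    obtain ⟨n, hn⟩ := IsPGroup.iff_orderOf.1 P.isPGroup' ⟨x, hx⟩
    rw [Subgroup.orderOf_mk] at hn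
    have hq3 : 3 = q := by
      by_contra hne
      refine hxk (weights_three' hodd ρ hρ K (hab K hK4) x (fun h => hne ?_) k hk)
      rw [hn] at h
      exact (Nat.prime_dvd_prime_iff_eq Nat.prime_three hq.out).1 (Nat.prime_three.dvd_of_dvd_pow h)
    subst hq3
    refine ⟨K, x, n, hK1, ?_, hK3, hK4, hn, ⟨k, hk, hxk⟩,
      weights_three hodd ρ hρ K (hab K hK4) x⟩
    apply Subgroup.isComplement'_of_disjoint_and_mul_eq_univ
    · exact hK2.disjoint.mono_right (Subgroup.zpowers_le.2 hx)
    · have : K ⊔ Subgroup.zpowers x = ⊤ := by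
        by_contra h
        exact hxk (hab _ h _ (Subgroup.mem_sup_right (Subgroup.mem_zpowers x)) _
          (Subgroup.mem_sup_left hk))
      rw [← Subgroup.normal_mul, this]; rfl

theorem struct_aux {A : Type*} [AddCommGroup A] [Finite A] (σ : A →+ A)
    (hσ3 : ∀ a, σ (σ (σ a)) = a) (h3 : ¬ 3 ∣ Nat.card A) (hodd : Odd (Nat.card A))
    (hne : ∃ a, σ a ≠ a)
    (hirr : ∀ L : AddSubgroup A, L ≠ ⊤ → (∀ a ∈ L, σ a ∈ L) → ∀ a ∈ L, σ a = a) :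
    (∀ a, σ a = a → a = 0) ∧ ∃ p : ℕ, p.Prime ∧ 5 ≤ p ∧
      ((p % 3 = 1 ∧ Nonempty (A ≃+ ZMod p)) ∨
       (p % 3 = 2 ∧ Nonempty (A ≃+ ZMod p × ZMod p))) := by
  have h3inj : ∀ a : A, 3 • a = 0 → a = 0 := by
    intro a ha
    have h1 := addOrderOf_dvd_of_nsmul_eq_zero ha
    rcases (Nat.dvd_prime Nat.prime_three).1 h1 with h | h
    · exact AddMonoid.addOrderOf_eq_one_iff.1 h
    · exact absurd (h ▸ addOrderOf_dvd_natCard a) h3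
  let d : A →+ A := AddMonoidHom.id A - σ
  have hd : ∀ a, d a = a - σ a := fun a => rfl
  have hdtop : d.range = ⊤ := by
    by_contra h
    obtain ⟨a, ha⟩ := hne
    have h1 := hirr d.range h (by
      rintro _ ⟨b, rfl⟩
      exact ⟨σ b, by simp [hd]⟩) (d a) ⟨a, rfl⟩
    rw [hd, map_sub] at h1
    have h2 : σ (σ a) = 2 • σ a - a := by
      rw [two_nsmul, ← sub_eq_zero]
      rw [← sub_eq_zero] at h1
      rw [← neg_eq_zero, ← h1]; abel
    have h4 := hσ3 a
    rw [h2, map_sub, map_nsmul, h2] at h4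
    apply ha
    rw [← sub_eq_zero]
    apply h3inj
    rw [← sub_eq_zero] at h4
    rw [← h4]; abel
  have hdinj : Function.Injective d :=
    Finite.injective_iff_surjective.2 (AddMonoidHom.range_eq_top.1 hdtop)
  have hfix : ∀ a, σ a = a → a = 0 := fun a ha =>
    (injective_iff_map_eq_zero d).1 hdinj a (by rw [hd, ha, sub_self])
  refine ⟨hfix, ?_⟩
  have hbot : ∀ L : AddSubgroup A, (∀ a ∈ L, σ a ∈ L) → L ≠ ⊤ → L = ⊥ := fun L hL h =>
    (AddSubgroup.eq_bot_iff_forall L).2 fun a ha => hfix a (hirr L h hL a ha)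
  have hN : ∀ a, σ (σ a) = - a - σ a := by
    intro a
    have : a + σ a + σ (σ a) = 0 := by
      apply hfix
      rw [map_add, map_add, hσ3]; abel
    rw [← sub_eq_zero, ← this]; abel
  obtain ⟨a₀, ha₀⟩ := hne
  have ha0 : a₀ ≠ 0 := by rintro rfl; simp at ha₀
  have : Nontrivial A := ⟨a₀, 0, ha0⟩
  obtain ⟨p, hp, hpd⟩ := Nat.exists_prime_and_dvd (Finite.one_lt_card (α := A)).ne'
  have : Fact p.Prime := ⟨hp⟩
  have hp3 : p ≠ 3 := by rintro rfl; exact h3 hpd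
  have hp2 : p ≠ 2 := by
    rintro rfl
    exact (Nat.not_even_iff_odd.2 hodd) (even_iff_two_dvd.2 hpd)
  have hp5 : 5 ≤ p := by
    have := hp.two_le
    by_contra! h
    interval_cases p
    · exact hp2 rfl
    · exact hp3 rfl
    · exact absurd hp (by norm_num)
  have hpA : ∀ a : A, p • a = 0 := by
    have h1 : (nsmulAddMonoidHom (α := A) p).range ≠ ⊤ := by
      intro h
      have hinj := Finite.injective_iff_surjective.2 (AddMonoidHom.range_eq_top.1 h)
      obtain ⟨b, hb⟩ := exists_prime_addOrderOf_dvd_card' p hpd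
      have hb0 : b = 0 := (injective_iff_map_eq_zero _).1 hinj b (by
        rw [nsmulAddMonoidHom_apply, ← hb, addOrderOf_nsmul_eq_zero])
      rw [hb0, addOrderOf_zero] at hb
      exact hp.one_lt.ne hb
    have h2 := hbot _ (by
      rintro _ ⟨b, rfl⟩
      exact ⟨σ b, by simp⟩) h1
    intro a
    have : p • a ∈ (nsmulAddMonoidHom (α := A) p).range := ⟨a, rfl⟩
    rwa [h2, AddSubgroup.mem_bot] at this
  obtain ⟨instM⟩ : Nonempty (Module (ZMod p) A) := ⟨AddCommGroup.zmodModule hpA⟩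
  have hsm : ∀ (c : ZMod p) a, σ (c • a) = c • σ a := fun c a => ZMod.map_smul σ c a
  have hspan : ∀ L : Submodule (ZMod p) A, (∀ a ∈ L, σ a ∈ L) → L ≠ (⊥ : Submodule (ZMod p) A) →
      L = (⊤ : Submodule (ZMod p) A) := by
    intro L hL hb
    by_contra h
    apply hb
    have := hbot L.toAddSubgroup hL (fun h' => h (by
      rw [eq_top_iff]
      intro a _
      have : a ∈ L.toAddSubgroup := h' ▸ AddSubgroup.mem_top a
      exact this))
    rw [Submodule.eq_bot_iff]
    intro a ha
    have h2 : a ∈ L.toAddSubgroup := ha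
    rwa [this, AddSubgroup.mem_bot] at h2
  -- eigenvectors
  have heig : ∀ (c : ZMod p) (a : A), a ≠ 0 → σ a = c • a →
      Module.finrank (ZMod p) A = 1 ∧ c ^ 2 + c + 1 = 0 := by
    intro c a ha hc
    constructor
    · refine (finrank_eq_one_iff_of_nonzero a ha).2 (hspan _ ?_ ?_)
      · intro b hb
        obtain ⟨r, rfl⟩ := Submodule.mem_span_singleton.1 hb
        rw [hsm, hc]
        exact Submodule.smul_mem _ _ (Submodule.smul_mem _ _ (Submodule.mem_span_singleton_self a))
      · simpa using ha
    · have h1 := hN a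
      rw [hc, hsm, hc] at h1
      have : (c ^ 2 + c + 1) • a = 0 := by
        rw [add_smul, add_smul, pow_two, mul_smul, h1, one_smul]; abel
      exact (smul_eq_zero.1 this).resolve_right ha
  have h30 : (3 : ZMod p) ≠ 0 := by
    intro h
    have : ((3 : ℕ) : ZMod p) = 0 := by exact_mod_cast h
    rw [ZMod.natCast_eq_zero_iff] at this
    exact hp3 ((Nat.prime_dvd_prime_iff_eq hp Nat.prime_three).1 this)
  have hle : Module.finrank (ZMod p) A ≤ 2 := by
    have h1 : Submodule.span (ZMod p) (Set.range ![a₀, σ a₀]) = ⊤ := by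
      have hm1 : a₀ ∈ Submodule.span (ZMod p) (Set.range ![a₀, σ a₀]) :=
        Submodule.subset_span ⟨0, rfl⟩
      have hm2 : σ a₀ ∈ Submodule.span (ZMod p) (Set.range ![a₀, σ a₀]) :=
        Submodule.subset_span ⟨1, rfl⟩
      apply hspan
      · intro b hb
        induction hb using Submodule.span_induction with
        | mem b hb =>
          obtain ⟨i, rfl⟩ := hb
          fin_cases i
          · exact hm2
          · change σ (σ a₀) ∈ _
            rw [hN]
            exact Submodule.sub_mem _ (Submodule.neg_mem _ hm1) hm2
        | zero => simp
        | add u v _ _ hu hv => rw [map_add]; exact Submodule.add_mem _ hu hv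
        | smul c u _ hu => rw [hsm]; exact Submodule.smul_mem _ _ hu
      · intro h
        rw [h, Submodule.mem_bot] at hm1
        exact ha0 hm1
    have h2 := finrank_range_le_card (R := ZMod p) ![a₀, σ a₀]
    rw [Set.finrank, h1, finrank_top] at h2
    simpa using h2
  have hpos : 0 < Module.finrank (ZMod p) A := Module.finrank_pos
  have hmod0 : p % 3 ≠ 0 := fun h => hp3
    ((Nat.prime_dvd_prime_iff_eq Nat.prime_three hp).1 (Nat.dvd_of_mod_eq_zero h)).symm
  refine ⟨p, hp, hp5, ?_⟩
  by_cases h1 : Module.finrank (ZMod p) A = 1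
  · left
    obtain ⟨c, hc⟩ := exists_smul_eq_of_finrank_eq_one h1 ha0 (σ a₀)
    have hc2 := (heig c a₀ ha0 hc.symm).2
    have hc3 : c ^ 3 = 1 := by linear_combination (c - 1) * hc2
    have hc1 : c ≠ 1 := by
      rintro rfl
      apply h30
      rw [← hc2]; norm_num
    have hord : orderOf c = 3 := by
      have : Fact (Nat.Prime 3) := ⟨Nat.prime_three⟩
      exact orderOf_eq_prime hc3 hc1
    have hc0 : c ≠ 0 := by rintro rfl; simp at hc3
    have hdvd := orderOf_dvd_of_pow_eq_one (ZMod.pow_card_sub_one_eq_one hc0)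
    rw [hord] at hdvd
    refine ⟨by omega, ⟨?_⟩⟩
    exact (LinearEquiv.ofFinrankEq A (ZMod p) (by rw [h1, Module.finrank_self])).toAddEquiv
  · have h2 : Module.finrank (ZMod p) A = 2 := by omega
    right
    refine ⟨?_, ⟨(LinearEquiv.ofFinrankEq A (ZMod p × ZMod p) (by
      rw [h2, Module.finrank_prod, Module.finrank_self])).toAddEquiv⟩⟩
    by_contra hmod
    have hm1 : p % 3 = 1 := by omega
    have : Fact (Nat.Prime 3) := ⟨Nat.prime_three⟩
    obtain ⟨u, hu⟩ := exists_prime_orderOf_dvd_card (G := (ZMod p)ˣ) 3 (by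
      rw [ZMod.card_units]; omega)
    have hu3 : (u : ZMod p) ^ 3 = 1 := by
      have := pow_orderOf_eq_one u
      rw [hu] at this
      rw [← Units.val_pow_eq_pow_val, this, Units.val_one]
    have hu1 : (u : ZMod p) ≠ 1 := by
      intro h
      have : u = 1 := Units.ext h
      rw [this, orderOf_one] at hu
      omega
    have hu2 : (u : ZMod p) ^ 2 + u + 1 = 0 := by
      have : ((u : ZMod p) - 1) * ((u : ZMod p) ^ 2 + u + 1) = 0 := by linear_combination hu3
      exact (mul_eq_zero.1 this).resolve_left (sub_ne_zero.2 hu1)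
    generalize (u : ZMod p) = c at hu3 hu1 hu2
    by_cases hb : σ a₀ = c • a₀
    · exact h1 (heig c a₀ ha0 hb).1
    · refine h1 (heig (c ^ 2) (σ a₀ - c • a₀) (sub_ne_zero.2 hb) ?_).1
      rw [map_sub, hsm, hN, smul_sub, smul_smul, show c ^ 2 * c = 1 by linear_combination hu3,
        show c ^ 2 = - 1 - c by linear_combination hu2, one_smul, sub_smul, neg_smul, one_smul]
      abel

theorem final_aux {G : Type*} [Group G] [Finite G]
    (hodd : Odd (Nat.card G))
    (hab : ∀ H : Subgroup G, H ≠ ⊤ → ∀ a ∈ H, ∀ b ∈ H, a * b = b * a)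
    (K : Subgroup G) (x : G) (n : ℕ) (hKn : K.Normal) (hc : K.IsComplement' (Subgroup.zpowers x))
    (hK3 : ¬ 3 ∣ Nat.card K) (hKt : K ≠ ⊤) (hn : orderOf x = 3 ^ n)
    (hxk : ∃ k ∈ K, x * k ≠ k * x) (hx3 : ∀ k ∈ K, Commute (x ^ 3) k) :
    ∃ p : ℕ, p.Prime ∧ 5 ≤ p ∧ 1 ≤ n ∧ Subgroup.center G = Subgroup.zpowers (x ^ 3) ∧
      ((p % 3 = 1 ∧ Nonempty (K ≃* Multiplicative (ZMod p))) ∨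
       (p % 3 = 2 ∧ Nonempty (K ≃* Multiplicative (ZMod p) × Multiplicative (ZMod p)))) := by
  let _ : CommGroup K := { (inferInstance : Group K) with
    mul_comm := fun a b => Subtype.ext (hab K hKt a a.2 b b.2) }
  let σ : Additive K →+ Additive K := ((MulAut.conjNormal x : MulAut K) : K →* K).toAdditive
  have hσ : ∀ k : K, σ (Additive.ofMul k) = Additive.ofMul ((MulAut.conjNormal x : MulAut K) k) :=
    fun k => rfl
  have hσfix : ∀ k : K, σ (Additive.ofMul k) = Additive.ofMul k ↔ x * k = k * x := by
    intro k
    rw [hσ, Additive.ofMul.injective.eq_iff, Subtype.ext_iff, MulAut.conjNormal_apply,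
      mul_inv_eq_iff_eq_mul]
  have hσ3 : ∀ a, σ (σ (σ a)) = a := by
    intro a
    obtain ⟨k, rfl⟩ := Additive.ofMul.surjective a
    rw [hσ, hσ, hσ]
    refine congrArg Additive.ofMul (Subtype.ext ?_)
    rw [MulAut.conjNormal_apply, MulAut.conjNormal_apply, MulAut.conjNormal_apply]
    have := (hx3 k k.2).eq
    calc x * (x * (x * (k : G) * x⁻¹) * x⁻¹) * x⁻¹ = x ^ 3 * k * (x ^ 3)⁻¹ := by simp only [pow_succ, pow_zero, one_mul, mul_inv_rev, mul_assoc]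
      _ = k := by rw [this]; group
  have hgen : K ⊔ Subgroup.zpowers x = ⊤ := hc.sup_eq_top
  have hdec : ∀ z : G, ∃ k ∈ K, ∃ j : ℤ, k * x ^ j = z := by
    intro z
    obtain ⟨⟨⟨k, hk⟩, ⟨y, ⟨j, rfl⟩⟩⟩, hz⟩ := hc.2 z
    exact ⟨k, hk, j, hz⟩
  have hirr : ∀ L : AddSubgroup (Additive K), L ≠ ⊤ → (∀ a ∈ L, σ a ∈ L) →
      ∀ a ∈ L, σ a = a := by
    intro L hL hinv a ha
    obtain ⟨k, rfl⟩ := Additive.ofMul.surjective a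
    rw [hσfix]
    let M : Subgroup G := (AddSubgroup.toSubgroup' L).map K.subtype
    have hmem : ∀ (k : K), (k : G) ∈ M ↔ Additive.ofMul k ∈ L := by
      intro k
      constructor
      · rintro ⟨k', hk', h⟩
        have : k' = k := Subtype.ext h
        exact this ▸ hk'
      · intro h
        exact ⟨k, h, rfl⟩
    have hMK : M ≤ K := by
      rintro _ ⟨k, -, rfl⟩
      exact k.2
    have hH : M ⊔ Subgroup.zpowers x ≠ ⊤ := by
      intro htop
      have hxn : x ∈ Subgroup.normalizer (M : Set G) := by
        rw [Subgroup.mem_normalizer_iff]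
        intro h
        constructor
        · intro hh
          have := hinv _ ((hmem ⟨h, hMK hh⟩).1 hh)
          rw [hσ, ← hmem, MulAut.conjNormal_apply] at this
          exact this
        · intro hh
          have hhK : h ∈ K := by
            have := hKn.conj_mem _ (hMK hh) x⁻¹
            simpa [mul_assoc] using this
          have h1 : σ (Additive.ofMul ⟨h, hhK⟩) ∈ L := by
            rw [hσ, ← hmem, MulAut.conjNormal_apply]
            exact hh
          have h2 := hinv _ (hinv _ h1)
          rw [hσ3] at h2
          exact (hmem ⟨h, hhK⟩).2 h2
      have hMn : M.Normal := by
        rw [← Subgroup.normalizer_eq_top_iff, eq_top_iff, ← htop]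
        exact sup_le Subgroup.le_normalizer (Subgroup.zpowers_le.2 hxn)
      apply hL
      rw [eq_top_iff]
      intro b _
      obtain ⟨b, rfl⟩ := Additive.ofMul.surjective b
      rw [← hmem]
      have hb : (b : G) ∈ M ⊔ Subgroup.zpowers x := htop ▸ Subgroup.mem_top _
      obtain ⟨m, hm, y, hy, hmy⟩ := Subgroup.mem_sup_of_normal_left.1 hb
      have hyK : y ∈ K := by
        have : y = m⁻¹ * b := by rw [← hmy]; group
        rw [this]
        exact K.mul_mem (K.inv_mem (hMK hm)) b.2
      have hy1 : y = 1 := Subgroup.disjoint_def.1 hc.disjoint hyK hy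
      rw [← hmy, hy1, mul_one]
      exact hm
    exact hab _ hH x (Subgroup.mem_sup_right (Subgroup.mem_zpowers x)) k
      (Subgroup.mem_sup_left ((hmem k).2 ha))
  have hneσ : ∃ a, σ a ≠ a := by
    obtain ⟨k, hk, hne⟩ := hxk
    exact ⟨Additive.ofMul ⟨k, hk⟩, fun h => hne ((hσfix ⟨k, hk⟩).1 h)⟩
  obtain ⟨hfix, p, hp, hp5, hcase⟩ := struct_aux σ hσ3 hK3
    (hodd.of_dvd_nat (Subgroup.card_subgroup_dvd_card K)) hneσ hirr
  refine ⟨p, hp, hp5, ?_, ?_, ?_⟩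
  · rcases Nat.eq_zero_or_pos n with h0 | h0
    · exfalso
      rw [h0, pow_zero, orderOf_eq_one_iff] at hn
      obtain ⟨k, hk, hne⟩ := hxk
      exact hne (by rw [hn]; simp)
    · exact h0
  · apply le_antisymm
    · intro z hz
      rw [Subgroup.mem_center_iff] at hz
      obtain ⟨k, hk, j, rfl⟩ := hdec z
      have hk1 : k = 1 := by
        have h1 : x * k = k * x := by
          have := hz x
          have h2 : x ^ j * x = x * x ^ j := ((Commute.refl x).zpow_left j).eq
          rw [mul_assoc, h2, ← mul_assoc, ← mul_assoc] at this
          exact mul_right_cancel this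
        have := hfix _ ((hσfix ⟨k, hk⟩).2 h1)
        exact congrArg Subtype.val (Additive.ofMul.injective this)
      subst hk1
      rw [one_mul] at hz ⊢
      by_cases hj : (3 : ℤ) ∣ j
      · obtain ⟨i, rfl⟩ := hj
        refine ⟨i, ?_⟩
        change (x ^ 3) ^ i = _
        rw [zpow_mul]; norm_cast
      · exfalso
        obtain ⟨k, hk, hne⟩ := hxk
        apply hne
        have hcop : IsCoprime (3 : ℤ) j :=
          (Int.prime_three.coprime_iff_not_dvd).2 hj
        obtain ⟨u, v, huv⟩ := hcop
        have hxe : x = (x ^ 3) ^ u * (x ^ j) ^ v := by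
          have h3 : x ^ 3 = x ^ (3 : ℤ) := by norm_cast
          rw [h3, ← zpow_mul, ← zpow_mul, ← zpow_add, mul_comm (3 : ℤ), mul_comm j, huv, zpow_one]
        have hcx : Commute x k := by
          rw [hxe]
          exact ((hx3 k hk).zpow_left u).mul_left
            (Commute.zpow_left (show Commute (x ^ j) k from (hz k).symm) v)
        exact hcx.eq
    · rw [Subgroup.zpowers_le, Subgroup.mem_center_iff]
      intro z
      obtain ⟨k, hk, j, rfl⟩ := hdec z
      exact (((hx3 k hk).mul_right (((Commute.refl x).pow_left 3).zpow_right j)).eq).symm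
  · rcases hcase with ⟨h1, ⟨e⟩⟩ | ⟨h1, ⟨e⟩⟩
    · left
      refine ⟨h1, ⟨?_⟩⟩
      exact MulEquiv.mk' ((Additive.ofMul (α := K)).trans (e.toEquiv.trans Multiplicative.ofAdd))
        (fun a b => congrArg Multiplicative.ofAdd (e.map_add (Additive.ofMul a) (Additive.ofMul b)))
    · right
      refine ⟨h1, ⟨?_⟩⟩
      exact (MulEquiv.mk' ((Additive.ofMul (α := K)).trans (e.toEquiv.trans Multiplicative.ofAdd))
        (fun a b => congrArg Multiplicative.ofAdd
          (e.map_add (Additive.ofMul a) (Additive.ofMul b)))).trans (MulEquiv.prodMultiplicative _ _)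

theorem stmt_19 (G : Type*) [Group G] [Finite G]
    (hna : ¬ ∀ a b : G, a * b = b * a) (hodd : Odd (Nat.card G))
    (h3 : ¬ IsPGroup 3 G) (h : MinFaithful G 3) :
    ∃ p n : ℕ, p.Prime ∧ 5 ≤ p ∧ 1 ≤ n ∧
      ((p % 3 = 1 ∧
        ∃ φ : Multiplicative (ZMod (3 ^ n)) →* MulAut (Multiplicative (ZMod p)),
          Nonempty (G ≃* (Multiplicative (ZMod p) ⋊[φ] Multiplicative (ZMod (3 ^ n)))) ∧
          IsCyclic (Subgroup.center G) ∧ Nat.card (Subgroup.center G) = 3 ^ (n - 1)) ∨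
       (p % 3 = 2 ∧
        ∃ φ : Multiplicative (ZMod (3 ^ n)) →*
            MulAut (Multiplicative (ZMod p) × Multiplicative (ZMod p)),
          Nonempty (G ≃* ((Multiplicative (ZMod p) × Multiplicative (ZMod p)) ⋊[φ]
            Multiplicative (ZMod (3 ^ n)))) ∧
          IsCyclic (Subgroup.center G) ∧ Nat.card (Subgroup.center G) = 3 ^ (n - 1))) := by
  obtain ⟨h, hH⟩ := h
  have hne : {n : ℕ | ∃ ρ : G →* GL (Fin n) ℂ, Function.Injective ρ}.Nonempty := by
    by_contra hemp
    rw [Set.not_nonempty_iff_eq_empty] at hemp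
    rw [rdim, hemp, Nat.sInf_empty] at h
    omega
  have hmem := Nat.sInf_mem hne
  change rdim G ∈ _ at hmem
  rw [h] at hmem
  obtain ⟨ρ, hρ⟩ := hmem
  have hab : ∀ H : Subgroup G, H ≠ ⊤ → ∀ a ∈ H, ∀ b ∈ H, a * b = b * a := by
    intro H hHt a ha b hb
    have hlt := hH H hHt
    have hneH : {n : ℕ | ∃ ρ : H →* GL (Fin n) ℂ, Function.Injective ρ}.Nonempty :=
      ⟨3, ρ.comp H.subtype, hρ.comp H.subtype_injective⟩
    obtain ⟨ρ', hρ'⟩ := Nat.sInf_mem hneH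
    have hle : rdim H ≤ 2 := by omega
    have := comm_of_two (Nat.card H) H rfl
      (hodd.of_dvd_nat (Subgroup.card_subgroup_dvd_card H)) hle ρ' hρ' ⟨a, ha⟩ ⟨b, hb⟩
    exact congrArg Subtype.val this
  obtain ⟨K, x, n, hKn, hc, hK3, hKt, hn, hxk, hx3⟩ := main_split hna hodd h3 ρ hρ hab
  obtain ⟨p, hp, hp5, hn1, hcen, hcase⟩ :=
    final_aux hodd hab K x n hKn hc hK3 hKt hn hxk hx3
  have hcyc : IsCyclic (Subgroup.center G) := by rw [hcen]; infer_instance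
  have hcard : Nat.card (Subgroup.center G) = 3 ^ (n - 1) := by
    rw [hcen, Nat.card_zpowers, orderOf_pow_of_dvd (by norm_num)
      (by rw [hn]; exact dvd_pow_self 3 (by omega)), hn]
    obtain ⟨m, rfl⟩ : ∃ m, n = m + 1 := ⟨n - 1, by omega⟩
    rw [pow_succ]; simp
  have fg : Subgroup.zpowers x ≃* Multiplicative (ZMod (3 ^ n)) :=
    mulEquivOfCyclicCardEq (by rw [Nat.card_zpowers, hn]; simp)
  refine ⟨p, n, hp, hp5, hn1, ?_⟩
  rcases hcase with ⟨h1, ⟨fn⟩⟩ | ⟨h1, ⟨fn⟩⟩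
  · left
    exact ⟨h1, _, ⟨(SemidirectProduct.mulEquivSubgroup hc).symm.trans
      (SemidirectProduct.congr' fn fg)⟩, hcyc, hcard⟩
  · right
    exact ⟨h1, _, ⟨(SemidirectProduct.mulEquivSubgroup hc).symm.trans
      (SemidirectProduct.congr' fn fg)⟩, hcyc, hcard⟩
end
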